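/- arXiv:1203.2868 — 4 statements merged into one kernel-verified Lean document; each statement's English description precedes it below -/
import Mathlib

section
/- Fix an integer t ≥ 1 and a real number p with 0 < p < 1/(t+1). If F is a t-intersecting family of subsets of [n], then μ_p(F) ≤ p^t. -/
/-- `t`-intersecting families. -/
def TInt (t : ℕ) (F : Finset (Finset ℕ)) : Prop := ∀ A ∈ F, ∀ B ∈ F, t ≤ (A ∩ B).card

/-- The weight of a set in the cube of dimension `n`. -/
noncomputable def wt (p : ℝ) (n : ℕ) (S : Finset ℕ) : ℝ := p ^ S.card * (1 - p) ^ (n - S.card)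

/-- The shift of a set. -/
def shf (n j : ℕ) (A : Finset ℕ) : Finset ℕ := insert j (A.erase n)

/-- The shift relative to a family. -/
def phi (F : Finset (Finset ℕ)) (n j : ℕ) (A : Finset ℕ) : Finset ℕ :=
  if n ∈ A ∧ j ∉ A ∧ shf n j A ∉ F then shf n j A else A

lemma shf_card {n j : ℕ} {A : Finset ℕ} (hn : n ∈ A) (hj : j ∉ A) : (shf n j A).card = A.card := by
  unfold shf
  rw [Finset.card_insert_of_notMem (by simp [hj]), Finset.card_erase_of_mem hn]
  have := Finset.card_pos.mpr ⟨n, hn⟩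
  omega

lemma shf_inv {n j : ℕ} {A : Finset ℕ} (hn : n ∈ A) (hj : j ∉ A) :
    insert n ((shf n j A).erase j) = A := by
  unfold shf
  rw [Finset.erase_insert (by simp [hj]), Finset.insert_erase hn]

lemma phi_card (F : Finset (Finset ℕ)) (n j : ℕ) (A : Finset ℕ) :
    (phi F n j A).card = A.card := by
  unfold phi
  split_ifs with h
  · exact shf_card h.1 h.2.1
  · rfl

lemma phi_inj (F : Finset (Finset ℕ)) (n j : ℕ) : Set.InjOn (phi F n j) F := by
  intro A hA B hB h
  unfold phi at h
  split_ifs at h with h1 h2 h2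
  · rw [← shf_inv h1.1 h1.2.1, ← shf_inv h2.1 h2.2.1, h]
  · exact absurd (h ▸ hB) h1.2.2
  · exact absurd (h ▸ hA) h2.2.2
  · exact h

lemma moved_unmoved {t : ℕ} {F : Finset (Finset ℕ)} (hF : TInt t F) {n j : ℕ} (hj : j < n)
    {A B : Finset ℕ} (hA : A ∈ F) (hB : B ∈ F) (h1 : n ∈ A ∧ j ∉ A ∧ shf n j A ∉ F)
    (h2 : ¬ (n ∈ B ∧ j ∉ B ∧ shf n j B ∉ F)) : t ≤ (shf n j A ∩ B).card := by
  obtain ⟨hn, hjA, -⟩ := h1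
  by_cases hnB : n ∈ B
  · by_cases hjB : j ∈ B
    · have e : shf n j A ∩ B = shf n j (A ∩ B) := by
        ext x; simp only [shf, Finset.mem_inter, Finset.mem_insert, Finset.mem_erase]
        by_cases hx : x = j
        · subst hx; simp [hjB]
        · simp [hx]; tauto
      rw [e, shf_card (by simp [hn, hnB]) (by simp [hjA])]
      exact hF A hA B hB
    · have hB' : shf n j B ∈ F := by
        by_contra h; exact h2 ⟨hnB, hjB, h⟩
      refine (hF A hA _ hB').trans (Finset.card_le_card ?_)
      intro x
      simp only [shf, Finset.mem_inter, Finset.mem_insert, Finset.mem_erase]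
      rintro ⟨hx, rfl | hx2⟩
      · exact absurd hx hjA
      · exact ⟨Or.inr ⟨hx2.1, hx⟩, hx2.2⟩
  · refine (hF A hA _ hB).trans (Finset.card_le_card ?_)
    intro x
    simp only [shf, Finset.mem_inter, Finset.mem_insert, Finset.mem_erase]
    rintro ⟨hx, hx2⟩
    exact ⟨Or.inr ⟨fun h => hnB (h ▸ hx2), hx⟩, hx2⟩

lemma phi_tint {t : ℕ} {F : Finset (Finset ℕ)} (hF : TInt t F) {n j : ℕ} (hj : j < n) :
    TInt t (F.image (phi F n j)) := by
  intro A' hA' B' hB'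
  obtain ⟨A, hA, rfl⟩ := Finset.mem_image.mp hA'
  obtain ⟨B, hB, rfl⟩ := Finset.mem_image.mp hB'
  unfold phi
  split_ifs with h1 h2 h2
  · have e : shf n j A ∩ shf n j B = shf n j (A ∩ B) := by
      ext x; simp only [shf, Finset.mem_inter, Finset.mem_insert, Finset.mem_erase]; tauto
    rw [e, shf_card (by simp [h1.1, h2.1]) (by simp [h1.2.1])]
    exact hF A hA B hB
  · exact moved_unmoved hF hj hA hB h1 h2
  · rw [Finset.inter_comm]; exact moved_unmoved hF hj hB hA h2 h1
  · exact hF A hA B hB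

lemma exists_stable (p : ℝ) (t n : ℕ) : ∀ (c : ℕ) (F : Finset (Finset ℕ)),
    (F.filter (fun A => n ∈ A)).card = c → (∀ A ∈ F, A ⊆ Finset.range (n + 1)) → TInt t F →
    ∃ G : Finset (Finset ℕ), (∀ A ∈ G, A ⊆ Finset.range (n + 1)) ∧ TInt t G ∧
      ∑ S ∈ F, wt p (n + 1) S = ∑ S ∈ G, wt p (n + 1) S ∧
      ∀ A ∈ G, n ∈ A → ∀ j < n, j ∉ A → shf n j A ∈ G := by
  intro c
  induction c using Nat.strong_induction_on with
  | _ c ih =>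
    intro F hc hr hF
    by_cases hst : ∀ A ∈ F, n ∈ A → ∀ j < n, j ∉ A → shf n j A ∈ F
    · exact ⟨F, hr, hF, rfl, hst⟩
    push Not at hst
    obtain ⟨A, hA, hnA, j, hj, hjA, hs⟩ := hst
    have hlt : ((F.image (phi F n j)).filter (fun A => n ∈ A)).card < c := by
      rw [← hc]
      refine lt_of_le_of_lt (b := ((F.filter (fun A => n ∈ A)).erase A).card)
        (Finset.card_le_card ?_) (Finset.card_erase_lt_of_mem (by simp [hA, hnA]))
      intro B' hB'
      obtain ⟨hB', hn⟩ := Finset.mem_filter.mp hB'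
      obtain ⟨B, hB, rfl⟩ := Finset.mem_image.mp hB'
      unfold phi at hn ⊢
      split_ifs at hn ⊢ with h
      · simp [shf, hj.ne'] at hn
      · simp only [Finset.mem_erase, Finset.mem_filter]
        refine ⟨?_, hB, hn⟩
        rintro rfl
        exact h ⟨hnA, hjA, hs⟩
    obtain ⟨G, g1, g2, g3, g4⟩ := ih _ hlt (F.image (phi F n j)) rfl (by
      intro B' hB'
      obtain ⟨B, hB, rfl⟩ := Finset.mem_image.mp hB'
      unfold phi
      split_ifs with h
      · intro x hx
        simp only [shf, Finset.mem_insert, Finset.mem_erase] at hx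
        rcases hx with rfl | hx
        · simp; omega
        · exact hr B hB hx.2
      · exact hr B hB) (phi_tint hF hj)
    refine ⟨G, g1, g2, ?_, g4⟩
    rw [← g3, Finset.sum_image (phi_inj F n j)]
    simp [wt, phi_card]

lemma union_tint {t n : ℕ} {F F0 H K : Finset (Finset ℕ)} (hF : TInt t F)
    (hst : ∀ A ∈ F, n ∈ A → ∀ j < n, j ∉ A → shf n j A ∈ F)
    (h0 : ∀ A ∈ F0, A ∈ F ∧ n ∉ A)
    (hH : ∀ A ∈ H, insert n A ∈ F ∧ n ∉ A ∧ A ⊆ Finset.range n) (hKH : K ⊆ H)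
    (hK : ∀ A ∈ K, ∀ B ∈ K, A.card + B.card + 1 = n + t → ∃ k < n, k ∉ A ∧ k ∉ B) :
    TInt t (F0 ∪ K) := by
  have cross : ∀ A ∈ F0, ∀ B ∈ K, t ≤ (A ∩ B).card := by
    intro A hA B hB
    refine (hF A (h0 A hA).1 _ (hH B (hKH hB)).1).trans (Finset.card_le_card ?_)
    intro x
    simp only [Finset.mem_inter, Finset.mem_insert]
    rintro ⟨hx, rfl | hx2⟩
    · exact absurd hx (h0 A hA).2
    · exact ⟨hx, hx2⟩
  intro A hA B hB
  rcases Finset.mem_union.mp hA with hA | hA <;> rcases Finset.mem_union.mp hB with hB | hB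
  · exact hF A (h0 A hA).1 B (h0 B hB).1
  · exact cross A hA B hB
  · rw [Finset.inter_comm]; exact cross B hB A hA
  · obtain ⟨a1, a2, a3⟩ := hH A (hKH hA)
    obtain ⟨b1, b2, b3⟩ := hH B (hKH hB)
    -- a common missing element forces a large intersection
    have key : ∀ k < n, k ∉ A → k ∉ B → t ≤ (A ∩ B).card := by
      intro k hk hkA hkB
      have := hst _ a1 (by simp) k hk (by simp [hkA, hk.ne])
      refine (hF _ this _ b1).trans (Finset.card_le_card ?_)
      intro x
      simp only [shf, Finset.mem_inter, Finset.mem_insert, Finset.mem_erase]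
      rintro ⟨rfl | hx, rfl | hx2⟩
      · omega
      · exact absurd hx2 hkB
      · exact absurd rfl hx.1
      · exact ⟨hx.2.resolve_left hx.1, hx2⟩
    by_contra hlt
    have hu : A ∪ B = Finset.range n := by
      refine Finset.Subset.antisymm (Finset.union_subset a3 b3) ?_
      intro k hk
      by_contra hk2
      simp only [Finset.mem_union, not_or] at hk2
      exact hlt (key k (Finset.mem_range.mp hk) hk2.1 hk2.2)
    have h1 := hF _ a1 _ b1
    rw [← Finset.insert_inter_distrib, Finset.card_insert_of_notMem (by simp [a2])] at h1
    have h2 := Finset.card_union_add_card_inter A B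
    rw [hu, Finset.card_range] at h2
    obtain ⟨k, hk, k1, k2⟩ := hK A hA B hB (by omega)
    exact hlt (key k hk k1 k2)

lemma wt_nonneg {p : ℝ} (hp0 : 0 < p) (hp1 : p ≤ 1) (n : ℕ) (S : Finset ℕ) : 0 ≤ wt p n S := by
  unfold wt
  have : 0 ≤ 1 - p := by linarith
  positivity

lemma avg {t n : ℕ} (ht : 1 ≤ t) (hn : t ≤ n) {p : ℝ} (hp0 : 0 < p) (hp1 : p ≤ 1)
    (hp : p * (t + 1) ≤ 1)
    (E : Finset (Finset ℕ)) (hE : ∀ A ∈ E, A ⊆ Finset.range n ∧ 2 * A.card + 1 = n + t) :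
    ∃ k < n, p * ∑ S ∈ E, wt p n S ≤ ∑ S ∈ E.filter (fun A => k ∉ A), wt p n S := by
  have hne : (Finset.range n).Nonempty := ⟨0, by simp; omega⟩
  obtain ⟨k, hk, h⟩ := Finset.exists_le_of_sum_le hne
    (f := fun _ => p * ∑ S ∈ E, wt p n S)
    (g := fun k => ∑ S ∈ E.filter (fun A => k ∉ A), wt p n S) (by
      simp only [Finset.sum_filter]
      rw [Finset.sum_comm, Finset.sum_const, Finset.card_range, nsmul_eq_mul, Finset.mul_sum,
        Finset.mul_sum]
      refine Finset.sum_le_sum fun A hA => ?_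
      obtain ⟨h1, h2⟩ := hE A hA
      rw [← Finset.sum_filter, Finset.sum_const, nsmul_eq_mul]
      have hc : (Finset.range n).filter (fun k => k ∉ A) = Finset.range n \ A := by
        ext x; simp
      have hc2 := Finset.card_sdiff_add_card_eq_card h1
      rw [Finset.card_range] at hc2
      rw [hc, ← mul_assoc]
      refine mul_le_mul_of_nonneg_right ?_ (wt_nonneg hp0 hp1 n A)
      set r := (Finset.range n \ A).card
      have hn' : n + 1 = 2 * r + t := by omega
      have hr : 1 ≤ r := by omega
      have hnr : (n : ℝ) + 1 = 2 * r + t := by exact_mod_cast hn'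
      have hr' : (1 : ℝ) ≤ r := by exact_mod_cast hr
      have ht' : (1 : ℝ) ≤ t := by exact_mod_cast ht
      have : (n : ℝ) ≤ r * (t + 1) := by nlinarith
      nlinarith)
  exact ⟨k, Finset.mem_range.mp hk, h⟩

lemma step {t n : ℕ} (ht : 1 ≤ t) (hn : t ≤ n) {p : ℝ} (hp0 : 0 < p)
    (hp : p * (t + 1) ≤ 1) (F : Finset (Finset ℕ)) (hr : ∀ A ∈ F, A ⊆ Finset.range (n + 1))
    (hF : TInt t F) (hst : ∀ A ∈ F, n ∈ A → ∀ j < n, j ∉ A → shf n j A ∈ F) :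
    ∃ G : Finset (Finset ℕ), (∀ A ∈ G, A ⊆ Finset.range n) ∧ TInt t G ∧
      ∑ S ∈ F, wt p (n + 1) S ≤ ∑ S ∈ G, wt p n S := by
  have ht' : (1 : ℝ) ≤ t := by exact_mod_cast ht
  have hp2 : p ≤ 1 / 2 := by nlinarith
  have hp1 : p ≤ 1 := by linarith
  have hrn : ∀ A : Finset ℕ, A ⊆ Finset.range (n + 1) → n ∉ A → A ⊆ Finset.range n := by
    intro A h1 h2 x hx
    have := Finset.mem_range.mp (h1 hx)
    have : x ≠ n := fun h => h2 (h ▸ hx)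
    simp; omega
  set F0 := F.filter (fun A => n ∉ A) with hF0
  set F1 := (F.filter (fun A => n ∈ A)).image (fun A => A.erase n) with hF1
  set H := F1 \ F0 with hHdef
  have h0 : ∀ A ∈ F0, A ∈ F ∧ n ∉ A := fun A hA => Finset.mem_filter.mp hA
  have hH : ∀ A ∈ H, insert n A ∈ F ∧ n ∉ A ∧ A ⊆ Finset.range n := by
    intro A hA
    obtain ⟨B, hB, rfl⟩ := Finset.mem_image.mp (Finset.mem_sdiff.mp hA).1
    obtain ⟨hB, hnB⟩ := Finset.mem_filter.mp hB
    refine ⟨by rwa [Finset.insert_erase hnB], by simp, ?_⟩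
    exact hrn _ ((Finset.erase_subset _ _).trans (hr B hB)) (by simp)
  have hw := wt_nonneg hp0 hp1 n
  have hsum : ∑ S ∈ F, wt p (n + 1) S ≤ ∑ S ∈ F0, wt p n S + p * ∑ S ∈ H, wt p n S := by
    rw [← Finset.sum_filter_add_sum_filter_not F (fun A => n ∈ A)]
    have e0 : ∑ S ∈ F.filter (fun A => ¬ n ∈ A), wt p (n + 1) S
        = (1 - p) * ∑ S ∈ F0, wt p n S := by
      rw [Finset.mul_sum]
      refine Finset.sum_congr rfl fun A hA => ?_
      have hc := Finset.card_le_card (hrn A (hr A (h0 A hA).1) (h0 A hA).2)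
      rw [Finset.card_range] at hc
      unfold wt
      rw [Nat.succ_sub hc, pow_succ]; ring
    have e1 : ∑ S ∈ F.filter (fun A => n ∈ A), wt p (n + 1) S = p * ∑ S ∈ F1, wt p n S := by
      rw [hF1, Finset.sum_image, Finset.mul_sum]
      · refine Finset.sum_congr rfl fun A hA => ?_
        have hnA := (Finset.mem_filter.mp hA).2
        have hc := Finset.card_erase_add_one hnA
        unfold wt
        rw [← hc, Nat.add_sub_add_right, pow_succ]; ring
      · intro A hA B hB h
        have hnA := (Finset.mem_filter.mp hA).2
        have hnB := (Finset.mem_filter.mp hB).2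
        simp only at h
        rw [← Finset.insert_erase hnA, h, Finset.insert_erase hnB]
    have e2 : ∑ S ∈ F1, wt p n S ≤ ∑ S ∈ F0, wt p n S + ∑ S ∈ H, wt p n S := by
      rw [← Finset.sum_union Finset.disjoint_sdiff]
      refine Finset.sum_le_sum_of_subset_of_nonneg ?_ fun _ _ _ => hw _
      rw [Finset.union_sdiff_self_eq_union]; exact Finset.subset_union_right
    rw [e0, e1]
    nlinarith
  set E := H.filter (fun A => 2 * A.card + 1 = n + t) with hE
  set L := H.filter (fun A => 2 * A.card + 1 < n + t) with hL
  set U := H.filter (fun A => n + t < 2 * A.card + 1) with hU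
  obtain ⟨k, hk, hkE⟩ := avg ht hn hp0 hp1 hp E (fun A hA =>
    ⟨(hH A (Finset.mem_filter.mp hA).1).2.2, (Finset.mem_filter.mp hA).2⟩)
  set E' := E.filter (fun A => k ∉ A) with hE'
  have hHs : ∑ S ∈ H, wt p n S = ∑ S ∈ L, wt p n S + ∑ S ∈ U, wt p n S + ∑ S ∈ E, wt p n S := by
    rw [hL, hU, hE, Finset.sum_filter, Finset.sum_filter, Finset.sum_filter,
      ← Finset.sum_add_distrib, ← Finset.sum_add_distrib]
    refine Finset.sum_congr rfl fun A _ => ?_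
    rcases lt_trichotomy (2 * A.card + 1) (n + t) with h | h | h
    · simp [h, h.ne, h.not_gt]
    · simp [h]
    · simp [h, h.ne', h.not_gt]
  have fin : ∀ X : Finset (Finset ℕ), X ⊆ H → Disjoint X E' →
      (∀ A ∈ X ∪ E', ∀ B ∈ X ∪ E', A.card + B.card + 1 = n + t → ∃ k < n, k ∉ A ∧ k ∉ B) →
      p * (∑ S ∈ L, wt p n S + ∑ S ∈ U, wt p n S) ≤ ∑ S ∈ X, wt p n S →
      ∃ G : Finset (Finset ℕ), (∀ A ∈ G, A ⊆ Finset.range n) ∧ TInt t G ∧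
      ∑ S ∈ F, wt p (n + 1) S ≤ ∑ S ∈ G, wt p n S := by
    intro X hX hd hK hs
    have hKH : X ∪ E' ⊆ H := Finset.union_subset hX
      ((Finset.filter_subset _ _).trans (Finset.filter_subset _ _))
    refine ⟨F0 ∪ (X ∪ E'), ?_, union_tint hF hst h0 hH hKH hK, ?_⟩
    · intro A hA
      rcases Finset.mem_union.mp hA with hA | hA
      · exact hrn A (hr A (h0 A hA).1) (h0 A hA).2
      · exact (hH A (hKH hA)).2.2
    · rw [Finset.sum_union (Finset.disjoint_of_subset_right hKH Finset.disjoint_sdiff),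
        Finset.sum_union hd]
      refine hsum.trans ?_
      rw [hHs]
      linarith
  have hL0 : 0 ≤ ∑ S ∈ L, wt p n S := Finset.sum_nonneg fun _ _ => hw _
  have hU0 : 0 ≤ ∑ S ∈ U, wt p n S := Finset.sum_nonneg fun _ _ => hw _
  have mE' : ∀ A ∈ E', 2 * A.card + 1 = n + t ∧ k ∉ A := fun A hA =>
    ⟨(Finset.mem_filter.mp (Finset.mem_filter.mp hA).1).2, (Finset.mem_filter.mp hA).2⟩
  have mL : ∀ A ∈ L, 2 * A.card + 1 < n + t := fun A hA => (Finset.mem_filter.mp hA).2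
  have mU : ∀ A ∈ U, n + t < 2 * A.card + 1 := fun A hA => (Finset.mem_filter.mp hA).2
  rcases le_total (∑ S ∈ L, wt p n S) (∑ S ∈ U, wt p n S) with h | h
  · refine fin U (Finset.filter_subset _ _) ?_ ?_ (by nlinarith)
    · rw [Finset.disjoint_left]
      intro A h1 h2
      have := mU A h1
      have := (mE' A h2).1
      omega
    · intro A hA B hB hAB
      refine ⟨k, hk, ?_⟩
      rcases Finset.mem_union.mp hA with hA | hA <;> rcases Finset.mem_union.mp hB with hB | hB
      · have := mU A hA; have := mU B hB; omega
      · have := mU A hA; have := (mE' B hB).1; omega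
      · have := mU B hB; have := (mE' A hA).1; omega
      · exact ⟨(mE' A hA).2, (mE' B hB).2⟩
  · refine fin L (Finset.filter_subset _ _) ?_ ?_ (by nlinarith)
    · rw [Finset.disjoint_left]
      intro A h1 h2
      have := mL A h1
      have := (mE' A h2).1
      omega
    · intro A hA B hB hAB
      refine ⟨k, hk, ?_⟩
      rcases Finset.mem_union.mp hA with hA | hA <;> rcases Finset.mem_union.mp hB with hB | hB
      · have := mL A hA; have := mL B hB; omega
      · have := mL A hA; have := (mE' B hB).1; omega
      · have := mL B hB; have := (mE' A hA).1; omega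
      · exact ⟨(mE' A hA).2, (mE' B hB).2⟩

lemma main_nat {t : ℕ} (ht : 1 ≤ t) {p : ℝ} (hp0 : 0 < p) (hp : p * (t + 1) ≤ 1) (n : ℕ) :
    ∀ F : Finset (Finset ℕ), (∀ A ∈ F, A ⊆ Finset.range n) → TInt t F →
      ∑ S ∈ F, wt p n S ≤ p ^ t := by
  have base : ∀ n ≤ t, ∀ F : Finset (Finset ℕ), (∀ A ∈ F, A ⊆ Finset.range n) → TInt t F →
      ∑ S ∈ F, wt p n S ≤ p ^ t := by
    intro n hn F hr hF
    have hc : ∀ A ∈ F, A = Finset.range n ∧ n = t := by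
      intro A hA
      have h1 := hF A hA A hA
      rw [Finset.inter_self] at h1
      have h2 := Finset.card_le_card (hr A hA)
      rw [Finset.card_range] at h2
      exact ⟨Finset.eq_of_subset_of_card_le (hr A hA) (by rw [Finset.card_range]; omega),
        by omega⟩
    rcases F.eq_empty_or_nonempty with rfl | ⟨A, hA⟩
    · simp; positivity
    · have hnt := (hc A hA).2
      have : F = {Finset.range n} := by
        ext B
        simp only [Finset.mem_singleton]
        exact ⟨fun h => (hc B h).1, fun h => h ▸ (hc A hA).1 ▸ hA⟩
      rw [this]
      simp [wt, hnt]
  induction n with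
  | zero => exact base 0 (Nat.zero_le _)
  | succ n ih =>
    intro F hr hF
    by_cases hn : n + 1 ≤ t
    · exact base _ hn F hr hF
    obtain ⟨G, g1, g2, g3, g4⟩ := exists_stable p t n _ F rfl hr hF
    obtain ⟨G', k1, k2, k3⟩ := step ht (by omega) hp0 hp G g1 g2 g4
    rw [g3]
    exact k3.trans (ih G' k1 k2)

/-- Dinur–Safra / Friedgut: for t ≥ 1 and 0 < p < 1/(t+1), every t-intersecting
family F of subsets of [n] has p-biased measure μ_p(F) ≤ p^t. -/
theorem stmt_12 (t : ℕ) (ht : 1 ≤ t) (p : ℝ) (hp0 : 0 < p) (hp : p < 1 / (t + 1))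
    (n : ℕ) (F : Finset (Finset (Fin n)))
    (hF : ∀ A ∈ F, ∀ B ∈ F, t ≤ (A ∩ B).card) :
    ∑ S ∈ F, p ^ S.card * (1 - p) ^ (n - S.card) ≤ p ^ t := by
  have hp' : p * (t + 1) ≤ 1 := by
    rw [lt_div_iff₀ (by positivity)] at hp
    exact hp.le
  have h := main_nat ht hp0 hp' n (F.image (fun A => A.map Fin.valEmbedding)) (by
    intro A hA
    obtain ⟨B, -, rfl⟩ := Finset.mem_image.mp hA
    intro x hx
    obtain ⟨y, -, rfl⟩ := Finset.mem_map.mp hx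
    simp) (by
    intro A hA B hB
    obtain ⟨A, hA2, rfl⟩ := Finset.mem_image.mp hA
    obtain ⟨B, hB2, rfl⟩ := Finset.mem_image.mp hB
    rw [← Finset.map_inter, Finset.card_map]
    exact hF A hA2 B hB2)
  rw [Finset.sum_image (fun A _ B _ h => Finset.map_injective _ h)] at h
  simpa [wt] using h
end

section
/- Let t ≥ c ≥ 2 be integers and let ℓ be an integer satisfying ℓ > (c−1)(t+1) and binom(ℓ, c−1) · ((c−1)/ℓ)^t < 1. Then every t-intersecting hypergraph on a finite vertex set admits a c-strong coloring using ℓ colors. -/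
open Polynomial in
/-- The linear functional of Friedgut's argument, vanishing on multiples of `X ^ t`. -/
noncomputable def frL (p : ℝ) (t : ℕ) (h : ℝ[X]) : ℝ :=
  ∑ j ∈ Finset.range t, h.coeff j * (p ^ j - p ^ t)

lemma alt_sum_bounds (n : ℕ) : ∀ a : ℕ → ℝ, (∀ i, 0 ≤ a i) → (∀ i, a (i + 1) ≤ a i) →
    0 ≤ ∑ i ∈ Finset.range n, (-1) ^ i * a i ∧ ∑ i ∈ Finset.range n, (-1) ^ i * a i ≤ a 0 := by
  induction n with
  | zero => intro a h0 _; simpa using h0 0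
  | succ n ih =>
    intro a h0 h1
    obtain ⟨h2, h3⟩ := ih (fun i => a (i + 1)) (fun i => h0 _) (fun i => h1 _)
    rw [Finset.sum_range_succ']
    have : ∑ i ∈ Finset.range n, (-1 : ℝ) ^ (i + 1) * a (i + 1)
        = - ∑ i ∈ Finset.range n, (-1) ^ i * a (i + 1) := by
      rw [← Finset.sum_neg_distrib]
      exact Finset.sum_congr rfl fun i _ => by ring
    rw [this]
    have := h1 0
    constructor <;> simp at * <;> linarith

open Polynomial in
lemma s_rec (p : ℝ) (s : ℕ) (h : ℝ[X]) :
    ∑ j ∈ Finset.range (s + 1), ((X + C (-p)) * h).coeff j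
      = (1 - p) * ∑ j ∈ Finset.range (s + 1), h.coeff j - h.coeff s := by
  have h1 : ∀ j, ((X + C (-p)) * h).coeff j = (X * h).coeff j - p * h.coeff j := by
    intro j; rw [add_mul, coeff_add, coeff_C_mul]; ring
  simp only [h1]
  rw [Finset.sum_sub_distrib, ← Finset.mul_sum, Finset.sum_range_succ']
  simp only [coeff_X_mul, coeff_X_mul_zero]
  rw [Finset.sum_range_succ]
  ring

open Polynomial in
lemma frL_rec (p : ℝ) (s : ℕ) (h : ℝ[X]) :
    frL p (s + 1) ((X + C (-p)) * h)
      = - (p ^ (s + 1) * (1 - p) * ∑ j ∈ Finset.range (s + 1), h.coeff j) := by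
  unfold frL
  have h1 : ∀ j, ((X + C (-p)) * h).coeff j = (X * h).coeff j - p * h.coeff j := by
    intro j; rw [add_mul, coeff_add, coeff_C_mul]; ring
  simp only [h1, sub_mul]
  rw [Finset.sum_sub_distrib, Finset.sum_range_succ']
  simp only [coeff_X_mul, coeff_X_mul_zero]
  have h2 : ∑ k ∈ Finset.range s, h.coeff k * (p ^ (k + 1) - p ^ (s + 1))
      = ∑ k ∈ Finset.range (s + 1), h.coeff k * (p ^ (k + 1) - p ^ (s + 1)) := by
    rw [Finset.sum_range_succ]; ring
  rw [h2, zero_mul, add_zero, ← Finset.sum_sub_distrib, Finset.mul_sum, ← Finset.sum_neg_distrib]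
  exact Finset.sum_congr rfl fun i _ => by ring

open Polynomial in
lemma T_small (p : ℝ) (s : ℕ) (m : ℕ) (hm : m ≤ s) :
    ∑ j ∈ Finset.range (s + 1), ((X + C (-p)) ^ m : ℝ[X]).coeff j = (1 - p) ^ m := by
  induction m with
  | zero => simp [coeff_one]
  | succ m ih =>
    rw [pow_succ', s_rec, ih (by omega), coeff_X_add_C_pow, Nat.choose_eq_zero_of_lt (by omega)]
    simp; ring

open Polynomial in
lemma T_large (p : ℝ) (hq : 1 - p ≠ 0) (s : ℕ) (r : ℕ) :
    (1 - p) * ((1 - p) ^ (s + r)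
      - ∑ j ∈ Finset.range (s + 1), ((X + C (-p)) ^ (s + r) : ℝ[X]).coeff j)
      = (1 - p) ^ r * ∑ i ∈ Finset.range r,
          (-1) ^ i * (((s + i).choose s : ℝ) * (p / (1 - p)) ^ i) := by
  induction r with
  | zero => rw [add_zero, T_small p s s le_rfl]; simp
  | succ r ih =>
    rw [← add_assoc, pow_succ' (X + C (-p)), s_rec, coeff_X_add_C_pow, Finset.sum_range_succ _ r,
      mul_add]
    have h1 : s + r - s = r := by omega
    rw [h1]
    have h2 : (1 - p) ^ (r + 1) * ((-1) ^ r * (((s + r).choose s : ℝ) * (p / (1 - p)) ^ r))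
        = (1 - p) * ((-p) ^ r * ((s + r).choose s : ℝ)) := by
      rw [div_pow, neg_pow p]; field_simp; ring
    rw [h2, pow_succ' (1 - p) r, mul_assoc, ← ih]
    ring

open Polynomial in
lemma T_nonneg (p : ℝ) (s : ℕ) (hp : 0 < p) (hpt : (s + 2 : ℝ) * p ≤ 1) (m : ℕ) :
    ∑ j ∈ Finset.range (s + 1), ((X + C (-p)) ^ m : ℝ[X]).coeff j ≤ (1 - p) ^ m := by
  have hs : (0 : ℝ) ≤ s := Nat.cast_nonneg s
  have hq : 0 < 1 - p := by nlinarith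
  rcases le_total m s with h | h
  · exact (T_small p s m h).le
  · obtain ⟨r, rfl⟩ := Nat.exists_eq_add_of_le h
    have h1 := T_large p hq.ne' s r
    have h2 := (alt_sum_bounds r (fun i => ((s + i).choose s : ℝ) * (p / (1 - p)) ^ i)
      (fun i => by positivity) (fun i => by
        have h3 : ((s + (i + 1)).choose s : ℝ) * (i + 1) = (s + i + 1) * ((s + i).choose s : ℝ) := by
          have := Nat.add_one_mul_choose_eq (s + i) i
          have e1 : (s + i + 1).choose (i + 1) = (s + (i + 1)).choose s := by
            exact Nat.choose_symm_of_eq_add (by omega)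
          have e2 : (s + i).choose i = (s + i).choose s := by
            exact Nat.choose_symm_of_eq_add (by omega)
          rw [e1, e2] at this
          exact_mod_cast this.symm
        have hi : (0 : ℝ) ≤ i := Nat.cast_nonneg i
        have h4 : ((s + (i + 1)).choose s : ℝ) ≤ (s + 1) * ((s + i).choose s : ℝ) := by
          have hC : (0 : ℝ) ≤ ((s + i).choose s : ℝ) := Nat.cast_nonneg _
          have : ((s + (i + 1)).choose s : ℝ) * (i + 1)
              ≤ ((s + 1) * ((s + i).choose s : ℝ)) * (i + 1) := by
            rw [h3]
            nlinarith [mul_nonneg (mul_nonneg hs hi) hC]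
          exact le_of_mul_le_mul_right this (by positivity)
        have h5 : (s + 1) * (p / (1 - p)) ≤ 1 := by
          rw [← mul_div_assoc, div_le_one hq]; linarith
        have hx : 0 ≤ p / (1 - p) := by positivity
        calc ((s + (i + 1)).choose s : ℝ) * (p / (1 - p)) ^ (i + 1)
            ≤ ((s + 1) * ((s + i).choose s : ℝ)) * (p / (1 - p)) ^ (i + 1) := by gcongr
          _ = (((s + i).choose s : ℝ) * (p / (1 - p)) ^ i) * ((s + 1) * (p / (1 - p))) := by ring
          _ ≤ (((s + i).choose s : ℝ) * (p / (1 - p)) ^ i) * 1 := by gcongr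
          _ = _ := by ring)).1
    have h3 := mul_nonneg (pow_nonneg hq.le r) h2
    rw [← h1] at h3
    have := nonneg_of_mul_nonneg_right h3 hq
    linarith

open Polynomial in
lemma frL_sum {ι : Type*} (p : ℝ) (t : ℕ) (s : Finset ι) (a : ι → ℝ) (h : ι → ℝ[X]) :
    frL p t (∑ i ∈ s, C (a i) * h i) = ∑ i ∈ s, a i * frL p t (h i) := by
  unfold frL
  simp only [finsetSum_coeff, coeff_C_mul, Finset.sum_mul, Finset.mul_sum]
  rw [Finset.sum_comm]
  exact Finset.sum_congr rfl fun i _ => Finset.sum_congr rfl fun j _ => by ring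

open Polynomial in
lemma frL_pow (p : ℝ) (s : ℕ) (hp : 0 < p) (hpt : (s + 2 : ℝ) * p ≤ 1) (m : ℕ) :
    - p ^ (s + 1) ≤ frL p (s + 1) ((C (1 - p)⁻¹ * (X + C (-p))) ^ (m + 1)) := by
  have hs : (0 : ℝ) ≤ s := Nat.cast_nonneg s
  have hq : 0 < 1 - p := by nlinarith
  have h1 : ((C (1 - p)⁻¹ * (X + C (-p))) ^ (m + 1) : ℝ[X])
      = ∑ i ∈ Finset.range 1, C (((1 - p)⁻¹) ^ (m + 1)) * ((X + C (-p)) * (X + C (-p)) ^ m) := by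
    rw [Finset.sum_range_one, mul_pow, C_pow, ← pow_succ']
  rw [h1, frL_sum p (s+1) (Finset.range 1) (fun _ => ((1 - p)⁻¹) ^ (m + 1))
    (fun _ => (X + C (-p)) * (X + C (-p)) ^ m), Finset.sum_range_one, frL_rec, inv_pow,
    ← div_eq_inv_mul, le_div_iff₀ (by positivity)]
  have h2 := T_nonneg p s hp hpt m
  have h3 : 0 ≤ p ^ (s + 1) * (1 - p) := by positivity
  have := mul_le_mul_of_nonneg_left h2 h3
  rw [pow_succ (1 - p) m]
  linarith

open Polynomial in
theorem biased_ekr {V : Type*} [Fintype V] [DecidableEq V] (p : ℝ) (s : ℕ) (hp : 0 < p)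
    (hpt : (s + 2 : ℝ) * p ≤ 1) (F : Finset (Finset V))
    (hF : ∀ A ∈ F, ∀ B ∈ F, s + 1 ≤ (A ∩ B).card) :
    ∑ A ∈ F, ∏ i, (if i ∈ A then p else 1 - p) ≤ p ^ (s + 1) := by
  have hs : (0 : ℝ) ≤ s := Nat.cast_nonneg s
  have hq : 0 < 1 - p := by nlinarith
  set w : Finset V → ℝ := fun A => ∏ i, (if i ∈ A then p else 1 - p) with hw
  have hwpos : ∀ A, 0 < w A := fun A => Finset.prod_pos fun i _ => by split_ifs <;> assumption
  set φ : Finset V → V → ℝ := fun A i => if i ∈ A then 1 - p else -p with hφ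
  set k : Finset V → Finset V → V → ℝ := fun A B i => φ A i * φ B i / (p * (1 - p)) with hk
  set G : Finset V → ℝ := fun S => ∑ A ∈ F, ∑ B ∈ F, w A * w B * ∏ i ∈ S, k A B i with hG
  set Y : ℝ[X] := C (1 - p)⁻¹ * (X + C (-p)) with hY
  set μ : ℝ := ∑ A ∈ F, w A with hμ
  have hG0 : ∀ S, 0 ≤ G S := by
    intro S
    have : G S = (∑ A ∈ F, w A * ∏ i ∈ S, φ A i) ^ 2 / ∏ i ∈ S, (p * (1 - p)) := by
      rw [sq, Finset.sum_mul_sum, Finset.sum_div]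
      refine Finset.sum_congr rfl fun A _ => ?_
      rw [Finset.sum_div]
      refine Finset.sum_congr rfl fun B _ => ?_
      simp only [hk, Finset.prod_div_distrib, Finset.prod_mul_distrib]
      ring
    rw [this]
    have : 0 < ∏ i ∈ S, (p * (1 - p)) := Finset.prod_pos fun i _ => by positivity
    positivity
  have hGe : G ∅ = μ ^ 2 := by
    simp only [hG, Finset.prod_empty, mul_one, hμ, sq, Finset.sum_mul_sum]
  have hGs : ∑ S, G S = μ := by
    simp only [hG]
    rw [Finset.sum_comm]
    refine Finset.sum_congr rfl fun A hA => ?_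
    rw [Finset.sum_comm]
    simp only [← Finset.mul_sum]
    have h1 : ∀ B, ∑ S : Finset V, ∏ i ∈ S, k A B i = ∏ i, (1 + k A B i) := by
      intro B
      rw [Finset.prod_one_add, Finset.powerset_univ]
    simp only [h1]
    rw [Finset.sum_eq_single A]
    · have : w A * ∏ i, (1 + k A A i) = 1 := by
        simp only [hw, ← Finset.prod_mul_distrib]
        refine Finset.prod_eq_one fun i _ => ?_
        simp only [hk, hφ]
        split_ifs <;> field_simp <;> ring
      rw [mul_assoc, this, mul_one]
    · intro B _ hBA
      have : ∃ i, ¬ (i ∈ B ↔ i ∈ A) := by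
        by_contra! h
        exact hBA (Finset.ext h)
      obtain ⟨i, hi⟩ := this
      rw [Finset.prod_eq_zero (Finset.mem_univ i), mul_zero]
      simp only [hk, hφ]
      by_cases h1 : i ∈ A <;> by_cases h2 : i ∈ B <;> simp [h1, h2] at hi ⊢ <;> field_simp <;> ring
    · intro h; exact absurd hA h
  have hL : ∀ A ∈ F, ∀ B ∈ F,
      ∑ S : Finset V, (∏ i ∈ S, k A B i) * frL p (s + 1) (Y ^ S.card) = 0 := by
    intro A hA B hB
    rw [← frL_sum p (s + 1) Finset.univ (fun S : Finset V => ∏ i ∈ S, k A B i)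
      (fun S => Y ^ S.card)]
    have h1 : ∑ S : Finset V, C (∏ i ∈ S, k A B i) * Y ^ S.card
        = ∏ i, (1 + C (k A B i) * Y) := by
      rw [Finset.prod_one_add, Finset.powerset_univ]
      refine Finset.sum_congr rfl fun S _ => ?_
      rw [Finset.prod_mul_distrib, Finset.prod_const, map_prod]
    rw [h1]
    have h2 : (X : ℝ[X]) ^ (s + 1) ∣ ∏ i, (1 + C (k A B i) * Y) := by
      refine (pow_dvd_pow X (hF A hA B hB)).trans ?_
      rw [← Finset.prod_const]
      refine (Finset.prod_dvd_prod_of_dvd _ (fun i => 1 + C (k A B i) * Y) ?_).trans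
        (Finset.prod_dvd_prod_of_subset _ _ _ (Finset.subset_univ _))
      intro i hi
      rw [Finset.mem_inter] at hi
      rw [X_dvd_iff]
      simp [hk, hφ, hY, hi.1, hi.2]
      field_simp
      ring
    rw [X_pow_dvd_iff] at h2
    unfold frL
    exact Finset.sum_eq_zero fun j hj => by rw [h2 j (Finset.mem_range.1 hj), zero_mul]
  have hLG : ∑ S : Finset V, frL p (s + 1) (Y ^ S.card) * G S = 0 := by
    simp only [hG, Finset.mul_sum]
    rw [Finset.sum_comm]
    refine Finset.sum_eq_zero fun A hA => ?_
    rw [Finset.sum_comm]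
    refine Finset.sum_eq_zero fun B hB => ?_
    have := congrArg (fun x => w A * w B * x) (hL A hA B hB)
    simp only [mul_zero, Finset.mul_sum] at this
    rw [← this]
    exact Finset.sum_congr rfl fun S _ => by ring
  have hlow : ∀ S : Finset V, -p ^ (s + 1) * G S + (if S = ∅ then G S else 0)
      ≤ frL p (s + 1) (Y ^ S.card) * G S := by
    intro S
    split_ifs with h
    · subst h
      have : frL p (s + 1) (Y ^ (∅ : Finset V).card) = 1 - p ^ (s + 1) := by
        simp [frL, coeff_one]
      rw [this]
      linarith
    · obtain ⟨m, hm⟩ := Nat.exists_eq_succ_of_ne_zero (Finset.card_ne_zero_of_mem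
        (Finset.nonempty_iff_ne_empty.2 h).choose_spec)
      rw [hm, add_zero]
      exact mul_le_mul_of_nonneg_right (frL_pow p s hp hpt m) (hG0 S)
  have hsum := Finset.sum_le_sum (fun S (_ : S ∈ (Finset.univ : Finset (Finset V))) => hlow S)
  rw [hLG, Finset.sum_add_distrib, ← Finset.mul_sum, hGs, Finset.sum_ite_eq' Finset.univ ∅ G,
    if_pos (Finset.mem_univ _), hGe] at hsum
  have hμ0 : 0 ≤ μ := Finset.sum_nonneg fun A _ => (hwpos A).le
  by_contra! hcon
  have hμp : 0 < μ := lt_of_le_of_lt (by positivity) hcon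
  nlinarith

lemma count_preimage {V : Type*} [Fintype V] [DecidableEq V] (ℓ : ℕ) (hℓ : 0 < ℓ)
    (S : Finset (Fin ℓ)) (A : Finset V) :
    (((Finset.univ : Finset (V → Fin ℓ)).filter
      (fun f => Finset.univ.filter (fun v => f v ∈ S) = A)).card : ℝ)
      = (ℓ : ℝ) ^ Fintype.card V *
        ∏ i, (if i ∈ A then (S.card / ℓ : ℝ) else 1 - (S.card / ℓ : ℝ)) := by
  have h1 : (Finset.univ : Finset (V → Fin ℓ)).filter
      (fun f => Finset.univ.filter (fun v => f v ∈ S) = A)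
      = Fintype.piFinset (fun v => if v ∈ A then S else Sᶜ) := by
    ext f
    simp only [Finset.mem_filter, Finset.mem_univ, true_and, Fintype.mem_piFinset, Finset.ext_iff]
    refine forall_congr' fun v => ?_
    by_cases h : v ∈ A <;> simp [h]
  rw [h1, Fintype.card_piFinset, ← Finset.card_univ, ← Finset.prod_const,
    ← Finset.prod_mul_distrib]
  push_cast
  refine Finset.prod_congr rfl fun v _ => ?_
  have : (ℓ : ℝ) ≠ 0 := by positivity
  split_ifs
  · field_simp
  · rw [Finset.card_compl, Fintype.card_fin, Nat.cast_sub (by simpa using S.card_le_univ)]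
    field_simp

/-- If t ≥ c ≥ 2 and ℓ satisfies ℓ > (c−1)(t+1) and C(ℓ, c−1)·((c−1)/ℓ)^t < 1, then
every t-intersecting hypergraph on a finite vertex set has a c-strong coloring with
ℓ colors. -/
theorem stmt_15 (t c ℓ : ℕ) (hc : 2 ≤ c) (ht : c ≤ t)
    (hℓ₁ : (c - 1) * (t + 1) < ℓ)
    (hℓ₂ : (ℓ.choose (c - 1) : ℝ) * (((c : ℝ) - 1) / ℓ) ^ t < 1)
    {V : Type*} [Fintype V] [DecidableEq V] (E : Set (Finset V))
    (hE : ∀ e₁ ∈ E, ∀ e₂ ∈ E, t ≤ (e₁ ∩ e₂).card) :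
    ∃ f : V → Fin ℓ, ∀ e ∈ E, min c e.card ≤ (e.image f).card := by
  classical
  obtain ⟨d, rfl⟩ : ∃ d, c = d + 1 := ⟨c - 1, by omega⟩
  obtain ⟨s, rfl⟩ : ∃ s, t = s + 1 := ⟨t - 1, by omega⟩
  simp only [Nat.add_sub_cancel, Nat.cast_add, Nat.cast_one, add_sub_cancel_right] at hℓ₁ hℓ₂
  have hℓ : 0 < ℓ := by omega
  have hℓR : (0 : ℝ) < ℓ := by exact_mod_cast hℓ
  have hd : 0 < d := by omega
  have hp : (0 : ℝ) < d / ℓ := by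
    have : (0 : ℝ) < d := by exact_mod_cast hd
    positivity
  have hpt : (s + 2 : ℝ) * (d / ℓ) ≤ 1 := by
    rw [← mul_div_assoc, div_le_one hℓR]
    have : ((d * (s + 1 + 1) : ℕ) : ℝ) < ℓ := by exact_mod_cast hℓ₁
    push_cast at this
    linarith
  have hdl : d ≤ ℓ := by nlinarith
  set F : Finset (Finset V) := Finset.univ.filter (fun A => ∃ e ∈ E, e ⊆ A) with hF
  have hFi : ∀ A ∈ F, ∀ B ∈ F, s + 1 ≤ (A ∩ B).card := by
    intro A hA B hB
    simp only [hF, Finset.mem_filter, Finset.mem_univ, true_and] at hA hB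
    obtain ⟨e, he, heA⟩ := hA
    obtain ⟨g, hg, hgB⟩ := hB
    exact (hE e he g hg).trans (Finset.card_le_card (Finset.inter_subset_inter heA hgB))
  have hekr := biased_ekr (d / ℓ : ℝ) s hp hpt F hFi
  set bad : Finset (Fin ℓ) → Finset (V → Fin ℓ) := fun S =>
    Finset.univ.filter (fun f => Finset.univ.filter (fun v => f v ∈ S) ∈ F) with hbad
  have hbadc : ∀ S ∈ Finset.powersetCard d (Finset.univ : Finset (Fin ℓ)),
      ((bad S).card : ℝ) ≤ (ℓ : ℝ) ^ Fintype.card V * (d / ℓ : ℝ) ^ (s + 1) := by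
    intro S hS
    have hSc : S.card = d := (Finset.mem_powersetCard.1 hS).2
    have h1 : (bad S).card = ∑ A ∈ F, ((Finset.univ : Finset (V → Fin ℓ)).filter
        (fun f => Finset.univ.filter (fun v => f v ∈ S) = A)).card := by
      rw [Finset.card_eq_sum_card_fiberwise (t := F)
        (f := fun f : V → Fin ℓ => Finset.univ.filter (fun v => f v ∈ S))]
      · refine Finset.sum_congr rfl fun A hA => ?_
        congr 1
        ext f
        simp only [hbad, Finset.mem_filter, Finset.mem_univ, true_and]
        constructor
        · exact fun h => h.2
        · exact fun h => ⟨h ▸ hA, h⟩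
      · intro f hf
        exact (Finset.mem_filter.1 hf).2
    rw [h1, Nat.cast_sum, Finset.sum_congr rfl (fun A _ => count_preimage ℓ hℓ S A),
      ← Finset.mul_sum, hSc]
    exact mul_le_mul_of_nonneg_left hekr (by positivity)
  have hun : (((Finset.powersetCard d (Finset.univ : Finset (Fin ℓ))).biUnion bad).card : ℝ)
      < (ℓ : ℝ) ^ Fintype.card V := by
    calc (((Finset.powersetCard d (Finset.univ : Finset (Fin ℓ))).biUnion bad).card : ℝ)
        ≤ ∑ S ∈ Finset.powersetCard d (Finset.univ : Finset (Fin ℓ)), ((bad S).card : ℝ) := by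
          exact_mod_cast Finset.card_biUnion_le
      _ ≤ ∑ S ∈ Finset.powersetCard d (Finset.univ : Finset (Fin ℓ)),
            (ℓ : ℝ) ^ Fintype.card V * (d / ℓ : ℝ) ^ (s + 1) := Finset.sum_le_sum hbadc
      _ = (ℓ : ℝ) ^ Fintype.card V * ((ℓ.choose d : ℝ) * (d / ℓ : ℝ) ^ (s + 1)) := by
          rw [Finset.sum_const, Finset.card_powersetCard, Finset.card_univ, Fintype.card_fin,
            nsmul_eq_mul]
          ring
      _ < (ℓ : ℝ) ^ Fintype.card V * 1 := mul_lt_mul_of_pos_left hℓ₂ (by positivity)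
      _ = _ := mul_one _
  have hex : ∃ f : V → Fin ℓ,
      f ∉ (Finset.powersetCard d (Finset.univ : Finset (Fin ℓ))).biUnion bad := by
    by_contra! h
    rw [Finset.eq_univ_of_forall h, Finset.card_univ, Fintype.card_fun, Fintype.card_fin] at hun
    push_cast at hun
    exact lt_irrefl _ hun
  obtain ⟨f, hf⟩ := hex
  refine ⟨f, fun e he => ?_⟩
  by_contra! hlt
  have hlt' : (e.image f).card ≤ d := by
    have := lt_of_lt_of_le hlt (min_le_left _ _)
    omega
  obtain ⟨S, hS1, hS2⟩ := Finset.exists_superset_card_eq hlt' (by simpa using hdl)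
  refine hf (Finset.mem_biUnion.2 ⟨S, Finset.mem_powersetCard.2 ⟨Finset.subset_univ _, hS2⟩, ?_⟩)
  simp only [hbad, hF, Finset.mem_filter, Finset.mem_univ, true_and]
  exact ⟨e, he, fun v hv => by simpa using hS1 (Finset.mem_image_of_mem f hv)⟩
end

section
/- Let t ≥ c ≥ 2 be integers and let ℓ be an integer with ℓ > (c−1)(t+1). Let G be a t-intersecting hypergraph on the finite vertex set [n], and color each vertex independently and uniformly at random with one of ℓ colors. Then the probability that the resulting coloring is not a c-strong coloring of G is at most binom(ℓ, c−1) · ((c−1)/ℓ)^t. -/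
open Polynomial Finset in
theorem aux_G (u : ℕ) (p q : ℝ) (hp : 0 < p) (hq : 0 < q) (hpq : q * (1 / p - 1) = 1)
    (hu : (u + 1 : ℝ) * q ≤ 1) (N : ℕ) :
    (-q) ^ N * ∑ i ∈ range (u + 1), (N.choose i : ℝ) * (-(1 / p)) ^ i ≤ 1 := by
  set x : ℝ := 1 / p with hx
  have hx0 : 0 < x := by positivity
  set G : ℕ → ℝ := fun N => (-q) ^ N * ∑ i ∈ range (u + 1), (N.choose i : ℝ) * (-x) ^ i with hG
  have hsmall : ∀ N ≤ u, G N = 1 := by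
    intro N hN
    have h1 : ∑ i ∈ range (u + 1), (N.choose i : ℝ) * (-x) ^ i = (-x + 1) ^ N := by
      rw [add_pow]
      symm
      rw [← Finset.sum_subset (Finset.range_mono (show N + 1 ≤ u + 1 by omega))]
      · exact Finset.sum_congr rfl (fun i _ => by simp; ring)
      · intro i _ hi
        rw [Nat.choose_eq_zero_of_lt (by simpa using hi)]; simp
    simp only [hG]
    rw [h1, ← mul_pow]
    rw [show -q * (-x + 1) = 1 by linarith, one_pow]
  set c : ℕ → ℝ := fun d => q ^ (u + 1 + d) * x ^ (u + 1) * ((u + d).choose u : ℝ) with hcdef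
  have hc0 : ∀ d, 0 ≤ c d := fun d => by simp only [hcdef]; positivity
  have hpas : ∀ (M : ℕ) (s : ℕ), ∑ i ∈ range (s + 1), ((M + 1).choose i : ℝ) * (-x) ^ i
      = (1 - x) * ∑ i ∈ range (s + 1), (M.choose i : ℝ) * (-x) ^ i
        - (M.choose s : ℝ) * (-x) ^ (s + 1) := by
    intro M s
    induction s with
    | zero => simp
    | succ s ih =>
      rw [Finset.sum_range_succ, ih, Finset.sum_range_succ _ (s + 1), Nat.choose_succ_succ]
      push_cast; ring
  have hrec : ∀ d, G (u + d + 1) = G (u + d) - (-1) ^ d * c d := by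
    intro d
    simp only [hG, hcdef]
    rw [hpas]
    have h2 : (-q) * (1 - x) = 1 := by linarith
    have h3 : (-q) ^ (u + d + 1) * (-x) ^ (u + 1) = (-1) ^ d * (q ^ (u + 1 + d) * x ^ (u + 1)) := by
      rw [neg_pow q, neg_pow x]
      have : (-1 : ℝ) ^ (u + d + 1) * (-1) ^ (u + 1) = (-1) ^ d := by
        rw [← pow_add, show u + d + 1 + (u + 1) = d + 2 * (u + 1) by ring, pow_add, pow_mul]; simp
      rw [← this]; ring
    set T := ∑ i ∈ range (u + 1), ((u + d).choose i : ℝ) * (-x) ^ i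
    calc _ = (-q) ^ (u + d) * T * ((-q) * (1 - x))
          - ((-q) ^ (u + d + 1) * (-x) ^ (u + 1)) * ((u + d).choose u : ℝ) := by ring
      _ = _ := by rw [h2, h3]; ring
  have hdec : ∀ d, c (d + 1) ≤ c d := by
    intro d
    have hid : ((u + d + 1).choose u : ℝ) * (d + 1) = ((u + d).choose u : ℝ) * (u + d + 1) := by
      have := Nat.choose_mul_succ_eq (u + d) u
      rw [show u + d + 1 - u = d + 1 by omega] at this
      exact_mod_cast this.symm
    have hk : q * ((u + d + 1).choose u : ℝ) ≤ ((u + d).choose u : ℝ) := by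
      have h5 : q * (u + d + 1) ≤ d + 1 := by
        have : q ≤ 1 := by nlinarith [(Nat.cast_nonneg u : (0:ℝ) ≤ u)]
        nlinarith [(Nat.cast_nonneg d : (0:ℝ) ≤ d)]
      have h6 : (0 : ℝ) < d + 1 := by positivity
      have h7 : (0 : ℝ) ≤ ((u + d).choose u : ℝ) := by positivity
      refine le_of_mul_le_mul_right ?_ h6
      rw [mul_assoc, hid]
      nlinarith
    simp only [hcdef]
    have : q ^ (u + 1 + (d + 1)) * x ^ (u + 1) * ((u + (d + 1)).choose u : ℝ)
      = (q ^ (u + 1 + d) * x ^ (u + 1)) * (q * ((u + d + 1).choose u : ℝ)) := by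
      rw [show u + (d + 1) = u + d + 1 by ring]; ring
    rw [this]
    exact mul_le_mul_of_nonneg_left hk (by positivity)
  have heven : ∀ j, G (u + 2 * j) ≤ 1 := by
    intro j
    induction j with
    | zero => exact (hsmall u le_rfl).le
    | succ j ih =>
      have h1 := hrec (2 * j)
      have h2 := hrec (2 * j + 1)
      rw [pow_succ, pow_mul] at h2
      rw [pow_mul] at h1
      simp only [neg_one_sq, one_pow] at h1 h2
      have := hdec (2 * j)
      rw [show u + 2 * (j + 1) = u + (2 * j + 1) + 1 by ring, h2,
        show u + (2 * j + 1) = u + 2 * j + 1 by ring, h1]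
      linarith
  change G N ≤ 1
  rcases le_total N u with h | h
  · exact (hsmall N h).le
  · obtain ⟨d, rfl⟩ := Nat.exists_eq_add_of_le h
    rcases Nat.even_or_odd' d with ⟨j, rfl | rfl⟩
    · exact heven j
    · have h1 := hrec (2 * j)
      rw [pow_mul] at h1
      simp only [neg_one_sq, one_pow] at h1
      rw [show u + (2 * j + 1) = u + 2 * j + 1 by ring, h1]
      linarith [heven j, hc0 (2 * j)]

open Polynomial Finset in
theorem aux_poly (u : ℕ) (p q : ℝ) (hp : 0 < p) (hq : 0 < q) (hpq : q * (1 / p - 1) = 1)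
    (hu : (u + 1 : ℝ) * q ≤ 1) (B : ℝ[X]) (hB : ∀ k, 0 ≤ B.coeff k)
    (hd : (X + C q) ^ (u + 1) ∣ B) :
    B.coeff 0 * ((1 / p) ^ (u + 1) - 1) ≤ B.eval 1 - B.coeff 0 := by
  set b := B.divX with hb
  have hBb : B = X * b + C (B.coeff 0) := by rw [mul_comm]; exact (divX_mul_X_add B).symm
  set a := B.coeff 0
  have heval : B.eval 1 - a = b.eval 1 := by
    rw [hBb]; simp
  set T := taylor (-q) b with hT
  have htB : (X - C q) * T + C a = taylor (-q) B := by
    conv_rhs => rw [hBb]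
    rw [map_add, taylor_mul, taylor_X, taylor_C]
    simp [hT, sub_eq_add_neg]
  obtain ⟨D, hD⟩ := hd
  have hcz : ∀ i ≤ u, (taylor (-q) B).coeff i = 0 := by
    intro i hi
    rw [hD, taylor_mul, taylor_pow]
    simp only [map_add, taylor_X, taylor_C]
    rw [show X + C (-q) + C q = (X : ℝ[X]) by simp, coeff_X_pow_mul', if_neg (by omega)]
  have hτ : ∀ i ≤ u, q ^ (i + 1) * T.coeff i = a := by
    intro i
    induction i with
    | zero =>
      intro h
      have := hcz 0 h
      rw [← htB] at this
      simp [sub_mul, coeff_X_mul_zero] at this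
      simp; linarith
    | succ i ih =>
      intro h
      have := hcz (i + 1) h
      rw [← htB] at this
      simp [sub_mul, coeff_X_mul, coeff_C] at this
      have h2 := ih (by omega)
      rw [← h2, show T.coeff i = q * T.coeff (i + 1) by linarith]; ring
  have hx : (q / p) = 1 + q := by
    field_simp at hpq ⊢; linarith
  have hsum1 : ∑ i ∈ range (u + 1), (q / p) ^ i * T.coeff i = a * ((1 / p) ^ (u + 1) - 1) := by
    have h1 : ∀ i ∈ range (u + 1), (q / p) ^ i * T.coeff i = (a / q) * (1 / p) ^ i := by
      intro i hi
      rw [← hτ i (by simpa [Nat.lt_succ_iff] using hi)]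
      rw [div_pow, one_div, inv_pow]
      field_simp
      ring
    rw [Finset.sum_congr rfl h1, ← Finset.mul_sum]
    have := geom_sum_mul (1 / p) (u + 1)
    rw [← this]
    have : a / q = a * (1 / p - 1) := by
      rw [div_eq_iff hq.ne', mul_assoc, mul_comm (1/p - 1), hpq, mul_one]
    rw [this]; ring
  have hsum2 : ∑ i ∈ range (u + 1), (q / p) ^ i * T.coeff i
      = ∑ N ∈ range (b.natDegree + 1), b.coeff N *
        ((-q) ^ N * ∑ i ∈ range (u + 1), (N.choose i : ℝ) * (-(1 / p)) ^ i) := by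
    have h1 : ∀ i, T.coeff i = ∑ N ∈ range (b.natDegree + 1),
        b.coeff N * ((-q) ^ (N - i) * (N.choose i : ℝ)) := by
      intro i
      rw [hT, taylor_coeff, hasseDeriv_apply, Polynomial.sum_over_range, eval_finsetSum]
      · refine Finset.sum_congr rfl fun N _ => ?_
        simp; ring
      · simp
    simp_rw [h1, Finset.mul_sum]
    rw [Finset.sum_comm]
    refine Finset.sum_congr rfl fun N _ => Finset.sum_congr rfl fun i _ => ?_
    rcases le_or_gt i N with h | h
    · obtain ⟨d, rfl⟩ := Nat.exists_eq_add_of_le h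
      rw [Nat.add_sub_cancel_left, pow_add,
        show (q / p) ^ i = (-q) ^ i * (-(1 / p)) ^ i by rw [← mul_pow]; congr 1; ring]
      ring
    · rw [Nat.choose_eq_zero_of_lt h]; simp
  rw [heval, ← hsum1, hsum2, eval_eq_sum_range]
  refine Finset.sum_le_sum fun N _ => ?_
  rw [one_pow]
  refine mul_le_mul_of_nonneg_left (aux_G u p q hp hq hpq hu N) ?_
  rw [hb, coeff_divX]; exact hB _

noncomputable def bw (p : ℝ) (b : Bool) : ℝ := if b then p else 1 - p

noncomputable def bv (p : ℝ) (b : Bool) : ℝ := if b then √(p * (1 - p)) else -√(p * (1 - p))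

open Polynomial in
noncomputable def bW (p : ℝ) (a b : Bool) : ℝ[X] := C (bw p a * bw p b) + C (bv p a * bv p b) * X

open Polynomial Finset in
theorem aux_form (p : ℝ) (n : ℕ) (f : (Fin n → Bool) → ℝ) :
    ∑ x, ∑ y, (∏ i, bW p (x i) (y i)) * C (f x * f y)
      = ∑ S : Finset (Fin n), X ^ (Sᶜ.card) *
        C ((∑ x, f x * ((∏ i ∈ S, bw p (x i)) * ∏ i ∈ Sᶜ, bv p (x i))) ^ 2) := by
  have h : ∀ x y : Fin n → Bool, (∏ i, bW p (x i) (y i)) * C (f x * f y)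
      = ∑ S : Finset (Fin n), X ^ (Sᶜ.card) *
        C ((f x * ((∏ i ∈ S, bw p (x i)) * ∏ i ∈ Sᶜ, bv p (x i))) *
          (f y * ((∏ i ∈ S, bw p (y i)) * ∏ i ∈ Sᶜ, bv p (y i)))) := by
    intro x y
    unfold bW
    rw [Finset.prod_add, Finset.sum_mul, Finset.powerset_univ]
    refine Finset.sum_congr rfl fun S _ => ?_
    rw [← Finset.compl_eq_univ_sdiff]
    simp only [Finset.prod_mul_distrib, map_mul, Finset.prod_const, map_prod]
    ring
  simp_rw [h]
  rw [Finset.sum_congr rfl fun x _ => Finset.sum_comm, Finset.sum_comm]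
  refine Finset.sum_congr rfl fun S _ => ?_
  simp_rw [← Finset.mul_sum]
  rw [sq, Finset.sum_mul_sum]
  simp only [map_sum]

open Polynomial Finset in
theorem aux_measure (u : ℕ) (p : ℝ) (hp : 0 < p) (hp1 : p * (u + 2) ≤ 1) (n : ℕ)
    (F : Set (Fin n → Bool)) [DecidablePred (· ∈ F)]
    (hF : ∀ x ∈ F, ∀ y ∈ F, u + 1 ≤ (univ.filter fun i => x i = true ∧ y i = true).card) :
    ∑ x, (if x ∈ F then ∏ i, bw p (x i) else 0) ≤ p ^ (u + 1) := by
  have hu0 : (0 : ℝ) ≤ u := Nat.cast_nonneg u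
  have hp2 : p < 1 := by nlinarith
  have hp3 : 0 < 1 - p := by linarith
  set q : ℝ := p / (1 - p) with hqdef
  have hq : 0 < q := by positivity
  have hpq : q * (1 / p - 1) = 1 := by rw [hqdef]; field_simp
  have huq : (u + 1 : ℝ) * q ≤ 1 := by
    rw [hqdef, ← mul_div_assoc, div_le_one hp3]; nlinarith
  set f : (Fin n → Bool) → ℝ := fun x => if x ∈ F then 1 else 0 with hf
  set B : ℝ[X] := ∑ x, ∑ y, (∏ i, bW p (x i) (y i)) * C (f x * f y) with hB
  set m : ℝ := ∑ x, (if x ∈ F then ∏ i, bw p (x i) else 0) with hm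
  have hcoeff : ∀ k, 0 ≤ B.coeff k := by
    intro k
    rw [hB, aux_form, finsetSum_coeff]
    refine Finset.sum_nonneg fun S _ => ?_
    rw [coeff_mul_C, coeff_X_pow]
    split_ifs <;> positivity
  have h0 : B.coeff 0 = m ^ 2 := by
    rw [hB, aux_form, finsetSum_coeff, Finset.sum_eq_single univ]
    · rw [coeff_mul_C]; simp [hm, hf]
    · intro S _ hS
      rw [coeff_mul_C, coeff_X_pow, if_neg, zero_mul]
      intro h
      exact hS (by simpa using (Finset.card_eq_zero.mp h.symm))
    · simp
  have hsq : √(p * (1 - p)) * √(p * (1 - p)) = p * (1 - p) := Real.mul_self_sqrt (by positivity)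
  have h1 : B.eval 1 = m := by
    have hW : ∀ a b, (bW p a b).eval 1 = if a = b then bw p a else 0 := by
      intro a b
      cases a <;> cases b <;> simp [bW, bw, bv, hsq] <;> ring
    rw [hB, hm, eval_finsetSum]
    refine Finset.sum_congr rfl fun x _ => ?_
    rw [eval_finsetSum, Finset.sum_eq_single x]
    · simp only [eval_mul, eval_prod, hW, eval_C, hf]
      split_ifs <;> simp
    · intro y _ hy
      have : ∃ i, x i ≠ y i := by
        by_contra! h
        exact hy (funext fun i => (h i).symm)
      obtain ⟨i, hi⟩ := this
      rw [eval_mul, eval_prod, Finset.prod_eq_zero (mem_univ i) (by rw [hW, if_neg hi]), zero_mul]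
    · simp
  have hdvd : (X + C q) ^ (u + 1) ∣ B := by
    refine Finset.dvd_sum fun x _ => Finset.dvd_sum fun y _ => ?_
    by_cases hx : x ∈ F
    swap
    · simp [hf, hx]
    by_cases hy : y ∈ F
    swap
    · simp [hf, hy]
    refine Dvd.dvd.mul_right ?_ _
    refine (pow_dvd_pow _ (hF x hx y hy)).trans ?_
    rw [← Finset.prod_const]
    refine (Finset.prod_dvd_prod_of_dvd _ (fun i => bW p (x i) (y i)) ?_).trans
      (Finset.prod_dvd_prod_of_subset _ _ _ (Finset.filter_subset _ _))
    intro i hi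
    simp only [Finset.mem_filter, mem_univ, true_and] at hi
    refine ⟨C (p * (1 - p)), ?_⟩
    rw [hi.1, hi.2]
    simp only [bW, bw, bv, if_true, hsq]
    rw [add_mul, ← C_mul, show q * (p * (1 - p)) = p * p by rw [hqdef]; field_simp]
    ring
  have key := aux_poly u p q hp hq hpq huq B hcoeff hdvd
  rw [h0, h1] at key
  have hm0 : 0 ≤ m := by
    refine Finset.sum_nonneg fun x _ => ?_
    split_ifs
    · refine Finset.prod_nonneg fun i _ => ?_
      unfold bw; split_ifs <;> linarith
    · exact le_rfl
  have hle : m ^ 2 * (1 / p) ^ (u + 1) ≤ m := by linarith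
  rcases hm0.eq_or_lt with h | h
  · rw [← h]; positivity
  · have h5 : m * (1 / p) ^ (u + 1) ≤ 1 := by
      refine le_of_mul_le_mul_left ?_ h
      linarith [hle, show m * (m * (1 / p) ^ (u + 1)) = m ^ 2 * (1 / p) ^ (u + 1) by ring]
    rw [one_div, inv_pow, ← div_eq_mul_inv, div_le_one (by positivity)] at h5
    exact h5

open Finset in
theorem aux_count (u ℓ : ℕ) (n : ℕ) (S : Finset (Fin ℓ)) (hS : 0 < S.card)
    (hl : S.card * (u + 2) ≤ ℓ) (E : Set (Finset (Fin n)))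
    (hE : ∀ e₁ ∈ E, ∀ e₂ ∈ E, u + 1 ≤ (e₁ ∩ e₂).card) :
    ((@Finset.filter (Fin n → Fin ℓ) (fun f => ∃ e ∈ E, ∀ i ∈ e, f i ∈ S)
      (Classical.decPred _) Finset.univ).card : ℝ) / (ℓ : ℝ) ^ n
      ≤ ((S.card : ℝ) / ℓ) ^ (u + 1) := by
  classical
  have hl0 : 0 < ℓ := lt_of_lt_of_le (by positivity) hl
  have hl0' : (0 : ℝ) < ℓ := by exact_mod_cast hl0
  set F : Set (Fin n → Bool) := {x | ∃ e ∈ E, ∀ i ∈ e, x i = true} with hF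
  set p : ℝ := (S.card : ℝ) / ℓ with hp
  have hmeas := aux_measure u p (by rw [hp]; have : (0:ℝ) < S.card := by exact_mod_cast hS
                                    positivity)
    (by rw [hp, div_mul_eq_mul_div, div_le_one hl0']; exact_mod_cast hl) n F (by
      rintro x ⟨e, he, hxe⟩ y ⟨e', he', hye⟩
      refine (hE e he e' he').trans (Finset.card_le_card ?_)
      intro i hi
      rw [Finset.mem_inter] at hi
      simp [hxe i hi.1, hye i hi.2])
  refine le_trans (le_of_eq ?_) hmeas
  set φ : (Fin n → Fin ℓ) → (Fin n → Bool) := fun f i => decide (f i ∈ S) with hφ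
  have hfib : ∀ x : Fin n → Bool, ((univ.filter fun f => φ f = x).card : ℝ) / (ℓ : ℝ) ^ n
      = ∏ i, bw p (x i) := by
    intro x
    have h1 : (univ.filter fun f => φ f = x)
        = Fintype.piFinset fun i => if x i then S else Sᶜ := by
      ext f
      simp only [mem_filter, mem_univ, true_and, Fintype.mem_piFinset, hφ, funext_iff]
      refine forall_congr' fun i => ?_
      cases x i <;> simp
    rw [h1, Fintype.card_piFinset]
    have : (ℓ : ℝ) ^ n = ∏ _i : Fin n, (ℓ : ℝ) := by simp
    rw [this, Nat.cast_prod, ← Finset.prod_div_distrib]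
    refine Finset.prod_congr rfl fun i _ => ?_
    cases x i
    · have : S.card ≤ ℓ := by simpa using Finset.card_le_univ S
      simp [bw, hp, Finset.card_compl, Nat.cast_sub this]
      field_simp
    · simp [bw, hp]
  rw [Finset.card_eq_sum_card_fiberwise (f := φ) (t := univ) (by simp), Nat.cast_sum,
    Finset.sum_div]
  refine Finset.sum_congr rfl fun x _ => ?_
  have hiff : ∀ f, (∃ e ∈ E, ∀ i ∈ e, f i ∈ S) ↔ φ f ∈ F := by
    intro f; simp [hF, hφ]
  split_ifs with hx
  · rw [← hfib]
    congr 3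
    ext f
    simp only [mem_filter, mem_univ, true_and, hiff]
    exact ⟨fun h => h.2, fun h => ⟨h ▸ hx, h⟩⟩
  · rw [Finset.card_eq_zero.mpr, Nat.cast_zero, zero_div]
    ext f
    simp only [mem_filter, mem_univ, true_and, hiff, Finset.notMem_empty, iff_false]
    rintro ⟨h, rfl⟩
    exact hx h

/-- For t ≥ c ≥ 2 and ℓ > (c−1)(t+1): if G is a t-intersecting hypergraph on [n]
and each vertex is colored independently and uniformly at random with one of ℓ
colors, the probability that the coloring is not c-strong is at most
C(ℓ, c−1)·((c−1)/ℓ)^t. -/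
theorem stmt_16 (t c ℓ : ℕ) (hc : 2 ≤ c) (ht : c ≤ t)
    (hℓ : (c - 1) * (t + 1) < ℓ)
    (n : ℕ) (E : Set (Finset (Fin n)))
    (hE : ∀ e₁ ∈ E, ∀ e₂ ∈ E, t ≤ (e₁ ∩ e₂).card) :
    ((@Finset.filter (Fin n → Fin ℓ)
        (fun f => ¬ ∀ e ∈ E, min c e.card ≤ (e.image f).card)
        (Classical.decPred _) Finset.univ).card : ℝ) / (ℓ : ℝ) ^ n
      ≤ (ℓ.choose (c - 1) : ℝ) * (((c : ℝ) - 1) / ℓ) ^ t := by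
  classical
  obtain ⟨u, rfl⟩ : ∃ u, t = u + 1 := ⟨t - 1, by omega⟩
  have hl0 : 0 < ℓ := lt_of_le_of_lt (Nat.zero_le _) hℓ
  have hcl : c - 1 ≤ ℓ := by nlinarith
  have hsub : (@Finset.filter (Fin n → Fin ℓ)
        (fun f => ¬ ∀ e ∈ E, min c e.card ≤ (e.image f).card)
        (Classical.decPred _) Finset.univ) ⊆
      (Finset.powersetCard (c - 1) (Finset.univ : Finset (Fin ℓ))).biUnion fun S =>
        @Finset.filter (Fin n → Fin ℓ) (fun f => ∃ e ∈ E, ∀ i ∈ e, f i ∈ S)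
          (Classical.decPred _) Finset.univ := by
    intro f hf
    simp only [Finset.mem_filter, Finset.mem_univ, true_and, not_forall, not_le] at hf
    obtain ⟨e, he, hlt⟩ := hf
    have h1 : (e.image f).card ≤ c - 1 := by
      have := lt_of_lt_of_le hlt (min_le_left _ _); omega
    obtain ⟨S, hS, hSc⟩ := Finset.exists_superset_card_eq h1 (by simpa using hcl)
    simp only [Finset.mem_biUnion, Finset.mem_powersetCard, Finset.mem_filter, Finset.mem_univ,
      true_and]
    exact ⟨S, ⟨Finset.subset_univ _, hSc⟩, e, he,
      fun i hi => hS (Finset.mem_image_of_mem f hi)⟩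
  have hcard := (Finset.card_le_card hsub).trans Finset.card_biUnion_le
  have hcard' : ((@Finset.filter (Fin n → Fin ℓ)
        (fun f => ¬ ∀ e ∈ E, min c e.card ≤ (e.image f).card)
        (Classical.decPred _) Finset.univ).card : ℝ) ≤ _ := Nat.cast_le.mpr hcard
  refine (div_le_div_of_nonneg_right hcard' (by positivity)).trans ?_
  rw [Nat.cast_sum, Finset.sum_div]
  have hcc : ((c - 1 : ℕ) : ℝ) = (c : ℝ) - 1 := by
    rw [Nat.cast_sub (by omega)]; simp
  refine (Finset.sum_le_card_nsmul _ _ ((((c : ℝ) - 1) / ℓ) ^ (u + 1)) ?_).trans ?_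
  · intro S hS
    have hSc := (Finset.mem_powersetCard.mp hS).2
    have := aux_count u ℓ n S (by omega) (by rw [hSc]; exact hℓ.le) E hE
    rw [hSc, hcc] at this
    exact this
  · simp
end

section
/- For all integers t ≥ c ≥ 2, the integer ℓ = t^t satisfies ℓ > (c−1)(t+1) and binom(ℓ, c−1) · ((c−1)/ℓ)^t < 1; consequently, every t-intersecting hypergraph on a finite vertex set admits a c-strong coloring using t^t colors. -/
universe u

lemma aux_ineq (p q x y z w R T : ℝ) (hp : 0 ≤ p) (hq : 0 ≤ q) (hpq : p + q = 1)
    (hx : 0 ≤ x) (hz : 0 ≤ z)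
    (hT : q * T = p * R)
    (h1 : x * z ≤ T ^ 2) (h2 : x * w ≤ T ^ 2) (h3 : y * z ≤ T ^ 2) (h4 : y * w ≤ R ^ 2)
    (hy : 0 ≤ y) (hw : 0 ≤ w) :
    (q * x + p * y) * (q * z + p * w) ≤ T ^ 2 := by
  have hpq0 : 0 ≤ p * q := mul_nonneg hp hq
  have e1 : p * q * (x * w) ≤ p * q * T ^ 2 := mul_le_mul_of_nonneg_left h2 hpq0
  have e2 : p * q * (y * z) ≤ p * q * T ^ 2 := mul_le_mul_of_nonneg_left h3 hpq0
  have hone : T ^ 2 = q ^ 2 * T ^ 2 + p ^ 2 * T ^ 2 + 2 * (p * q * T ^ 2) := by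
    have : q = 1 - p := by linarith
    subst this; ring
  suffices h : q ^ 2 * (x * z) + p ^ 2 * (y * w) ≤ q ^ 2 * T ^ 2 + p ^ 2 * T ^ 2 by
    nlinarith
  by_cases hP : y * w ≤ T ^ 2
  · have := mul_le_mul_of_nonneg_left h1 (sq_nonneg q)
    have := mul_le_mul_of_nonneg_left hP (sq_nonneg p)
    linarith
  · push Not at hP
    have hP0 : 0 < y * w := lt_of_le_of_lt (sq_nonneg T) hP
    have hx4 : (x * z) * (y * w) ≤ T ^ 2 * T ^ 2 := by
      have := mul_le_mul h2 h3 (mul_nonneg hy hz) (sq_nonneg T)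
      linarith
    have hk : p ^ 2 * (y * w) ≤ q ^ 2 * T ^ 2 := by
      have := mul_le_mul_of_nonneg_left h4 (sq_nonneg p)
      have h5 : q ^ 2 * T ^ 2 = p ^ 2 * R ^ 2 := by rw [← mul_pow, hT, mul_pow]
      linarith
    have hm : 0 ≤ (y * w - T ^ 2) * (q ^ 2 * T ^ 2 - p ^ 2 * (y * w)) :=
      mul_nonneg (by linarith) (by linarith)
    have hx5 := mul_le_mul_of_nonneg_left hx4 (sq_nonneg q)
    refine le_of_mul_le_mul_right ?_ hP0
    nlinarith

open Classical in
/-- The biased measure of a family of subsets of `U`. -/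
noncomputable def biased {V : Type u} (p q : ℝ) (U : Finset V)
    (A : Finset V → Prop) : ℝ :=
  ∑ X ∈ U.powerset, if A X then p ^ X.card * q ^ (U.card - X.card) else 0

lemma biased_nonneg {V : Type u} (p q : ℝ) (hp : 0 ≤ p) (hq : 0 ≤ q) (U : Finset V)
    (A : Finset V → Prop) : 0 ≤ biased p q U A := by
  unfold biased
  refine Finset.sum_nonneg fun X _ => ?_
  split_ifs
  · positivity
  · exact le_rfl

lemma biased_insert {V : Type u} [DecidableEq V] (p q : ℝ) (U : Finset V) (a : V) (ha : a ∉ U)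
    (A : Finset V → Prop) :
    biased p q (insert a U) A =
      q * biased p q U A + p * biased p q U (fun X => A (insert a X)) := by
  unfold biased
  rw [Finset.sum_powerset_insert ha, Finset.mul_sum, Finset.mul_sum]
  congr 1
  · refine Finset.sum_congr rfl fun X hX => ?_
    have hc := Finset.card_le_card (Finset.mem_powerset.1 hX)
    rw [Finset.card_insert_of_notMem ha, Nat.sub_add_comm hc, pow_succ]
    split_ifs
    · ring
    · simp
  · refine Finset.sum_congr rfl fun X hX => ?_
    have hX' := Finset.mem_powerset.1 hX
    rw [Finset.card_insert_of_notMem ha,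
      Finset.card_insert_of_notMem (fun h => ha (hX' h)), Nat.add_sub_add_right, pow_succ]
    split_ifs
    · ring
    · simp

lemma biased_le_one {V : Type u} [DecidableEq V] (p q : ℝ) (hp : 0 ≤ p) (hq : 0 ≤ q)
    (hpq : p + q = 1) (U : Finset V) :
    ∀ A : Finset V → Prop, biased p q U A ≤ 1 := by
  induction U using Finset.induction_on with
  | empty =>
    intro A
    simp only [biased, Finset.powerset_empty, Finset.sum_singleton]
    split_ifs <;> simp
  | insert a U ha ih =>
    intro A
    rw [biased_insert p q U a ha]
    nlinarith [ih A, ih (fun X => A (insert a X))]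

lemma biased_cross {V : Type u} [DecidableEq V] (p q r : ℝ) (hp : 0 ≤ p) (hq : 0 ≤ q)
    (hpq : p + q = 1) (hr : q * r = p) (hr0 : 0 ≤ r) (U : Finset V) :
    ∀ (t : ℕ) (A B : Finset V → Prop),
      (∀ X Y, X ⊆ U → Y ⊆ U → A X → B Y → t ≤ (X ∩ Y).card) →
      biased p q U A * biased p q U B ≤ (r ^ t) ^ 2 := by
  induction U using Finset.induction_on with
  | empty =>
    intro t A B h
    rcases t with _ | t
    · have := biased_le_one p q hp hq hpq ∅ A
      have := biased_le_one p q hp hq hpq ∅ B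
      have := biased_nonneg p q hp hq ∅ A
      have := biased_nonneg p q hp hq ∅ B
      simp only [pow_zero, one_pow]
      nlinarith
    · have := h ∅ ∅ (by simp) (by simp)
      have h0 : (0 : ℝ) ≤ (r ^ (t + 1)) ^ 2 := by positivity
      simp only [biased, Finset.powerset_empty, Finset.sum_singleton]
      split_ifs with hA hB
      · simpa using this hA hB
      all_goals simpa using h0
  | insert a U ha ih =>
    intro t A B h
    rcases t with _ | t
    · have := biased_le_one p q hp hq hpq (insert a U) A
      have := biased_le_one p q hp hq hpq (insert a U) B
      have := biased_nonneg p q hp hq (insert a U) A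
      have := biased_nonneg p q hp hq (insert a U) B
      simp only [pow_zero, one_pow]
      nlinarith
    · rw [biased_insert p q U a ha, biased_insert p q U a ha]
      have hs : ∀ X, X ⊆ U → X ⊆ insert a U := fun X hX => hX.trans (Finset.subset_insert _ _)
      have hi : ∀ X, X ⊆ U → insert a X ⊆ insert a U :=
        fun X hX => Finset.insert_subset_insert _ hX
      refine aux_ineq p q _ _ _ _ (r ^ t) (r ^ (t + 1)) hp hq hpq
        (biased_nonneg p q hp hq _ _) (biased_nonneg p q hp hq _ _) ?_ ?_ ?_ ?_ ?_
        (biased_nonneg p q hp hq _ _) (biased_nonneg p q hp hq _ _)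
      · rw [pow_succ, ← hr]; ring
      · exact ih (t + 1) _ _ fun X Y hX hY => h X Y (hs X hX) (hs Y hY)
      · refine ih (t + 1) _ _ fun X Y hX hY hA hB => ?_
        have := h X (insert a Y) (hs X hX) (hi Y hY) hA hB
        rwa [Finset.inter_insert_of_notMem (fun h => ha (hX h))] at this
      · refine ih (t + 1) _ _ fun X Y hX hY hA hB => ?_
        have := h (insert a X) Y (hi X hX) (hs Y hY) hA hB
        rwa [Finset.insert_inter_of_notMem (fun h => ha (hY h))] at this
      · refine ih t _ _ fun X Y hX hY hA hB => ?_
        have := h (insert a X) (insert a Y) (hi X hX) (hi Y hY) hA hB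
        rw [← Finset.insert_inter_distrib, Finset.card_insert_of_notMem
          (fun h => ha (hX (Finset.mem_inter.1 h).1))] at this
        omega

lemma biased_inter {V : Type u} [DecidableEq V] (p q r : ℝ) (hp : 0 ≤ p) (hq : 0 ≤ q)
    (hpq : p + q = 1) (hr : q * r = p) (hr0 : 0 ≤ r) (U : Finset V)
    (t : ℕ) (A : Finset V → Prop)
    (h : ∀ X Y, A X → A Y → t ≤ (X ∩ Y).card) :
    biased p q U A ≤ r ^ t := by
  have := biased_cross p q r hp hq hpq hr hr0 U t A A fun X Y _ _ => h X Y
  rw [← sq] at this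
  exact le_of_sq_le_sq this (by positivity)

lemma count_eq {V : Type u} [Fintype V] [DecidableEq V] (l : ℕ) (hl : 0 < l) (S : Finset (Fin l))
    (A : Finset V → Prop) [DecidablePred A] :
    ((Finset.univ.filter fun f : V → Fin l => A (Finset.univ.filter fun v => f v ∈ S)).card : ℝ)
      = (l : ℝ) ^ Fintype.card V *
        biased ((S.card : ℝ) / l) (((l : ℝ) - S.card) / l) Finset.univ A := by
  classical
  have hl' : (l : ℝ) ≠ 0 := by positivity
  have hfib : ∀ X : Finset V,
      (Finset.univ.filter fun f : V → Fin l => (Finset.univ.filter fun v => f v ∈ S) = X).card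
        = S.card ^ X.card * (l - S.card) ^ (Fintype.card V - X.card) := by
    intro X
    have : (Finset.univ.filter fun f : V → Fin l => (Finset.univ.filter fun v => f v ∈ S) = X)
        = Fintype.piFinset fun v => if v ∈ X then S else Sᶜ := by
      ext f
      simp only [Finset.mem_filter, Finset.mem_univ, true_and, Fintype.mem_piFinset,
        Finset.ext_iff]
      refine forall_congr' fun v => ?_
      by_cases hv : v ∈ X <;> simp [hv]
    rw [this, Fintype.card_piFinset]
    simp only [apply_ite Finset.card, Finset.card_compl, Fintype.card_fin]
    rw [Finset.prod_ite]
    simp [Finset.filter_not, Finset.card_sdiff]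
  have hS : S.card ≤ l := by simpa using Finset.card_le_univ S
  rw [Finset.card_eq_sum_card_fiberwise (t := Finset.univ)
    (f := fun f : V → Fin l => (Finset.univ.filter fun v => f v ∈ S)) (by intro x _; simp)]
  unfold biased
  rw [Finset.mul_sum, Finset.powerset_univ]
  push_cast
  refine Finset.sum_congr rfl fun X _ => ?_
  rw [Finset.filter_filter]
  by_cases hA : A X
  · have : (Finset.univ.filter fun f : V → Fin l =>
        A (Finset.univ.filter fun v => f v ∈ S) ∧ (Finset.univ.filter fun v => f v ∈ S) = X)
        = (Finset.univ.filter fun f : V → Fin l =>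
          (Finset.univ.filter fun v => f v ∈ S) = X) := by
      refine Finset.filter_congr fun f _ => ?_
      constructor
      · exact fun h => h.2
      · exact fun h => ⟨h ▸ hA, h⟩
    rw [this, hfib, if_pos hA]
    push_cast [Nat.cast_sub hS]
    have hX : X.card ≤ Fintype.card V := Finset.card_le_univ X
    rw [Finset.card_univ, div_pow, div_pow]
    obtain ⟨m, hm⟩ := Nat.exists_eq_add_of_le hX
    rw [hm, Nat.add_sub_cancel_left, pow_add]
    field_simp
  · rw [if_neg hA, mul_zero, Nat.cast_eq_zero, Finset.card_eq_zero, Finset.filter_eq_empty_iff]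
    rintro f _ ⟨h1, h2⟩
    exact hA (h2 ▸ h1)

lemma num1 (u : ℕ) (hu : 1 ≤ u) : u ^ (u + 1) + (u + 1) * u < (u + 1) ^ (u + 1) := by
  obtain ⟨k, rfl⟩ := Nat.exists_eq_add_of_le' hu
  rcases k with _ | k
  · norm_num
  have h1 : (k + 1 + 1) ^ (k + 1) ≤ (k + 1 + 1 + 1) ^ (k + 1) := Nat.pow_le_pow_left (by omega) _
  have h2 : k + 1 + 1 + 1 ≤ (k + 1 + 1 + 1) ^ (k + 1) := Nat.le_self_pow (by omega) _
  have e1 : (k + 1 + 1) ^ (k + 1 + 1 + 1) = (k + 1 + 1) ^ (k + 1) * (k + 2) ^ 2 := by ring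
  have e2 : (k + 1 + 1 + 1) ^ (k + 1 + 1 + 1) = (k + 1 + 1 + 1) ^ (k + 1) * (k + 3) ^ 2 := by ring
  rw [e1, e2]
  nlinarith [Nat.mul_le_mul_right ((k + 2) ^ 2) h1, Nat.mul_le_mul_right (2 * k + 5) h2]

lemma num2 (t s : ℕ) (hs : 1 ≤ s) (hst : s + 1 ≤ t) :
    ((t ^ t).choose s : ℝ) * (s : ℝ) ^ t < ((t ^ t : ℕ) - (s : ℝ)) ^ t := by
  obtain ⟨u, rfl⟩ : ∃ u, t = u + 1 := ⟨t - 1, by omega⟩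
  have hn := num1 u (by omega)
  set l := (u + 1) ^ (u + 1) with hl
  have hlpos : 0 < l := by positivity
  have hul : u ≤ l := by
    have := Nat.le_mul_of_pos_left u (Nat.succ_pos u)
    have h0 := Nat.zero_le (u ^ (u + 1))
    simp only [Nat.succ_eq_add_one] at this
    linarith
  have hn' : (u : ℝ) ^ (u + 1) + (u + 1) * u < l := by exact_mod_cast hn
  have hlR : (0 : ℝ) < l := by exact_mod_cast hlpos
  have hsu : (s : ℝ) ≤ u := by exact_mod_cast (by omega : s ≤ u)
  have hul' : (u : ℝ) ≤ l := by exact_mod_cast hul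
  have h1 : (l.choose s : ℝ) ≤ (l : ℝ) ^ u := by
    exact_mod_cast (Nat.choose_le_pow l s).trans (Nat.pow_le_pow_right hlpos (by omega))
  have h2 : (s : ℝ) ^ (u + 1) ≤ (u : ℝ) ^ (u + 1) := by gcongr
  have h3 : ((l : ℝ) - u) ^ (u + 1) ≤ (l - s) ^ (u + 1) := by
    apply pow_le_pow_left₀ <;> linarith
  have h4 : (l : ℝ) ^ u * (l - (u + 1) * u) ≤ ((l : ℝ) - u) ^ (u + 1) := by
    have hle : -2 ≤ -((u : ℝ) / l) := by
      have : (u : ℝ) / l ≤ 1 := (div_le_one hlR).2 hul'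
      linarith
    have hb := one_add_mul_le_pow hle (u + 1)
    have := mul_le_mul_of_nonneg_left hb (by positivity : 0 ≤ (l : ℝ) ^ (u + 1))
    rw [← mul_pow] at this
    have e1 : (l : ℝ) * (1 + -((u : ℝ) / l)) = l - u := by
      field_simp
      ring
    have e2 : (l : ℝ) ^ (u + 1) * (1 + ((u + 1 : ℕ) : ℝ) * -((u : ℝ) / l))
        = (l : ℝ) ^ u * (l - (u + 1) * u) := by
      push_cast
      rw [pow_succ]
      field_simp
      ring
    rwa [e1, e2] at this
  calc (l.choose s : ℝ) * (s : ℝ) ^ (u + 1) ≤ (l : ℝ) ^ u * (u : ℝ) ^ (u + 1) := by gcongr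
    _ < (l : ℝ) ^ u * (l - (u + 1) * u) := by
      apply mul_lt_mul_of_pos_left _ (by positivity)
      linarith
    _ ≤ _ := h4.trans h3

/-- For all t ≥ c ≥ 2, ℓ = t^t satisfies ℓ > (c−1)(t+1) and C(ℓ, c−1)·((c−1)/ℓ)^t < 1;
consequently every t-intersecting hypergraph on a finite vertex set has a c-strong
coloring with t^t colors. -/
theorem stmt_17 (t c : ℕ) (hc : 2 ≤ c) (ht : c ≤ t) :
    ((c - 1) * (t + 1) < t ^ t ∧
      ((t ^ t).choose (c - 1) : ℝ) * (((c : ℝ) - 1) / (t ^ t : ℕ)) ^ t < 1) ∧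
    ∀ (V : Type u) [Fintype V] [DecidableEq V] (E : Set (Finset V)),
      (∀ e₁ ∈ E, ∀ e₂ ∈ E, t ≤ (e₁ ∩ e₂).card) →
      ∃ f : V → Fin (t ^ t), ∀ e ∈ E, min c e.card ≤ (e.image f).card := by
  obtain ⟨s, rfl⟩ : ∃ s, c = s + 1 := ⟨c - 1, by omega⟩
  have hmain := num2 t s (by omega) ht
  have hfirst : s * (t + 1) < t ^ t := by
    have h1 : t ^ 2 ≤ t ^ t := Nat.pow_le_pow_right (by omega) (by omega)
    nlinarith
  set l := t ^ t with hl
  have hsl : s < l := by nlinarith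
  have hlpos : 0 < l := by omega
  have hlR : (0 : ℝ) < l := by exact_mod_cast hlpos
  have hslR : (s : ℝ) < l := by exact_mod_cast hsl
  simp only [Nat.add_sub_cancel]
  refine ⟨⟨hfirst, ?_⟩, ?_⟩
  · push_cast
    rw [add_sub_cancel_right, div_pow, ← mul_div_assoc, div_lt_one (by positivity)]
    refine hmain.trans_le ?_
    apply pow_le_pow_left₀
    · linarith
    · have : (0 : ℝ) ≤ s := by positivity
      linarith
  · intro V _ _ E hE
    classical
    by_contra! hno
    let A : Finset V → Prop := fun X => ∃ e ∈ E, e ⊆ X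
    have hA : ∀ X Y, A X → A Y → t ≤ (X ∩ Y).card := by
      rintro X Y ⟨e, he, heX⟩ ⟨e', he', heY⟩
      exact (hE e he e' he').trans (Finset.card_le_card (Finset.inter_subset_inter heX heY))
    have hcover : (Finset.univ : Finset (V → Fin l)) ⊆
        (Finset.powersetCard s (Finset.univ : Finset (Fin l))).biUnion fun S =>
          Finset.univ.filter fun f : V → Fin l => A (Finset.univ.filter fun v => f v ∈ S) := by
      intro f _
      obtain ⟨e, he, hlt⟩ := hno f
      have hle : (e.image f).card ≤ s := by
        have := hlt.trans_le (min_le_left _ _)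
        omega
      obtain ⟨S, hS1, hS2⟩ := Finset.exists_superset_card_eq hle (by simpa using hsl.le)
      simp only [Finset.mem_biUnion, Finset.mem_powersetCard_univ, Finset.mem_filter,
        Finset.mem_univ, true_and]
      refine ⟨S, hS2, e, he, fun v hv => ?_⟩
      simp only [Finset.mem_filter, Finset.mem_univ, true_and]
      exact hS1 (Finset.mem_image_of_mem f hv)
    have hcard := (Finset.card_le_card hcover).trans Finset.card_biUnion_le
    have hR : ((l : ℝ)) ^ Fintype.card V ≤
        ∑ S ∈ Finset.powersetCard s (Finset.univ : Finset (Fin l)),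
          (((Finset.univ.filter fun f : V → Fin l =>
            A (Finset.univ.filter fun v => f v ∈ S)).card : ℕ) : ℝ) := by
      rw [Finset.card_univ, Fintype.card_fun, Fintype.card_fin] at hcard
      exact_mod_cast hcard
    have hbound : ∀ S ∈ Finset.powersetCard s (Finset.univ : Finset (Fin l)),
        (((Finset.univ.filter fun f : V → Fin l =>
            A (Finset.univ.filter fun v => f v ∈ S)).card : ℕ) : ℝ)
          ≤ (l : ℝ) ^ Fintype.card V * ((s : ℝ) / (l - s)) ^ t := by
      intro S hS
      rw [Finset.mem_powersetCard_univ] at hS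
      rw [count_eq l hlpos S A, hS]
      have hd : (0 : ℝ) < l - s := by linarith
      apply mul_le_mul_of_nonneg_left _ (by positivity)
      apply biased_inter _ _ _ (by positivity) (by positivity) _ _ (by positivity) _ _ _ hA
      · field_simp
        ring
      · field_simp
    have hsum := hR.trans (Finset.sum_le_sum hbound)
    rw [Finset.sum_const, Finset.card_powersetCard, Finset.card_univ, Fintype.card_fin,
      nsmul_eq_mul] at hsum
    have hd : (0 : ℝ) < l - s := by linarith
    have hlt : (l.choose s : ℝ) * ((s : ℝ) / (l - s)) ^ t < 1 := by
      rw [div_pow, ← mul_div_assoc, div_lt_one (by positivity)]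
      exact hmain
    have hpos : (0 : ℝ) < (l : ℝ) ^ Fintype.card V := by positivity
    nlinarith [mul_lt_mul_of_pos_left hlt hpos]
end
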